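/- Let G be an isometric multiple HNN extension of a finitely presented base group (A,X) with stable letters s_1,…,s_n. Any two geodesic words over (X ∪ {s_1,…,s_n})^{±1} representing the same element of G have parallel stable letter structure: deleting all letters of X^{±1} from each word yields the same sequence of stable letters s_i^{±1}. -/

import Mathlib

/-!  Common framework: words over an inverse-closed generating set, word length,
geodesics, falsification by fellow traveler property, almost convexity. -/

namespace ACPaper

section Core

variable {β G : Type*} [Group G]

/-- A letter is a generator (`Sum.inl`) or the formal inverse of a generator (`Sum.inr`);
this realizes the inverse-closed alphabet `X^{±1}`. -/
def letterEval (gen : β → G) : β ⊕ β → G :=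
  Sum.elim gen fun b => (gen b)⁻¹

/-- Evaluation of a word over `X^{±1}` in the group. -/
def eval (gen : β → G) (w : List (β ⊕ β)) : G :=
  (w.map (letterEval gen)).prod

/-- `gen` is a generating set: every element is represented by some word. -/
def Generates (gen : β → G) : Prop :=
  ∀ g : G, ∃ w : List (β ⊕ β), eval gen w = g

/-- Word length of a group element with respect to the generating set. -/
noncomputable def wlen (gen : β → G) (g : G) : ℕ :=
  sInf {n : ℕ | ∃ w : List (β ⊕ β), eval gen w = g ∧ w.length = n}

/-- A word is geodesic if its length equals the word length of the element it represents. -/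
def IsGeodesic (gen : β → G) (w : List (β ⊕ β)) : Prop :=
  w.length = wlen gen (eval gen w)

/-- The point reached after `t` steps along the unit-speed path labelled by `w`
(the path remains at its endpoint after time `w.length`). -/
def pos (gen : β → G) (w : List (β ⊕ β)) (t : ℕ) : G :=
  eval gen (w.take t)

/-- Synchronous falsification by fellow traveler property with constant `k`:
every non-geodesic word is synchronously `k`-fellow traveled by a shorter word
representing the same element. -/
def SynchFFTP (gen : β → G) (k : ℕ) : Prop :=
  ∀ w : List (β ⊕ β), ¬ IsGeodesic gen w →
    ∃ w' : List (β ⊕ β), eval gen w' = eval gen w ∧ w'.length < w.length ∧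
      ∀ t : ℕ, wlen gen ((pos gen w t)⁻¹ * pos gen w' t) ≤ k

/-- The path starting at `g` labelled by the word `w` stays in the ball of radius `N`
about the identity. -/
def PathInBall (gen : β → G) (N : ℕ) (g : G) (w : List (β ⊕ β)) : Prop :=
  ∀ t : ℕ, wlen gen (g * pos gen w t) ≤ N

/-- Almost convexity with constant `C`: any two elements of the sphere of radius `N ≥ 1`
at distance at most `2` are joined by a path of length at most `C` inside the ball of
radius `N`. -/
def AlmostConvexWith (gen : β → G) (C : ℕ) : Prop :=
  ∀ N : ℕ, 1 ≤ N → ∀ g g' : G, wlen gen g = N → wlen gen g' = N →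
    wlen gen (g⁻¹ * g') ≤ 2 →
    ∃ w : List (β ⊕ β), g * eval gen w = g' ∧ w.length ≤ C ∧ PathInBall gen N g w

/-- Almost convexity: almost convex with some positive constant. -/
def AlmostConvex (gen : β → G) : Prop :=
  ∃ C : ℕ, 0 < C ∧ AlmostConvexWith gen C


end Core

/-- Two letters are an inverse pair (`x` followed by `x⁻¹`, or `x⁻¹` followed by `x`). -/
def IsInvPair {β : Type*} : β ⊕ β → β ⊕ β → Prop
  | Sum.inl x, Sum.inr y => x = y
  | Sum.inr x, Sum.inl y => x = y
  | _, _ => False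

/-- A word over a formal alphabet `κ^{±1}` is freely reduced. -/
def FreelyReduced {κ : Type*} (l : List (κ ⊕ κ)) : Prop :=
  l.Chain' fun a b => ¬ IsInvPair a b

/-- Every geodesic word (over `X^{±1}`) representing an element of the subgroup generated
by `gens` is a concatenation of geodesic words, each representing an element of `gens` or
an inverse of one. -/
def TGConcat {β G : Type*} [Group G] (gen : β → G) (gens : Set G) : Prop :=
  ∀ w : List (β ⊕ β), IsGeodesic gen w → eval gen w ∈ Subgroup.closure gens →
    ∃ ps : List (List (β ⊕ β)), w = ps.flatten ∧
      ∀ p ∈ ps, IsGeodesic gen p ∧ ∃ g ∈ gens, eval gen p = g ∨ eval gen p = g⁻¹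

/-- Every freely reduced word in the elements `f j` and their inverses, read as a word over
`X^{±1}` (i.e. substituting geodesic representatives), is geodesic: the word length of the
element it represents is the sum of the word lengths of its letters. -/
def TGReducedGeodesic {β G κ : Type*} [Group G] (gen : β → G) (f : κ → G) : Prop :=
  ∀ l : List (κ ⊕ κ), FreelyReduced l →
    wlen gen (eval f l) =
      (l.map (Sum.elim (fun j => wlen gen (f j)) fun j => wlen gen (f j))).sum

/-- The subgroup generated by the family `f` is totally geodesic in `(G, gen)`. -/
def TotallyGeodesicSub {β G κ : Type*} [Group G] (gen : β → G) (f : κ → G) : Prop :=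
  TGConcat gen (Set.range f) ∧ TGReducedGeodesic gen f

/-- The data of a multiple HNN extension: a finitely generated base group
`A = ⟨X ∣ R⟩` and, for each stable letter `s_i` (`i ∈ Fin n`), words
`uw i j, vw i j` over `X` spelling the generators `u_{ij}` of `U_i` and
`v_{ij} = φ_i(u_{ij})` of `V_i`. -/
structure MHNNData where
  /-- the generating set of the base group -/
  X : Type
  /-- the generating set is finite -/
  fin : Fintype X
  /-- the relators of the base group -/
  R : Set (FreeGroup X)
  /-- the number of stable letters -/
  n : ℕ
  /-- the number of free generators of each associated subgroup -/
  m : Fin n → ℕ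
  /-- words spelling the free generators of the `U_i` -/
  uw : (i : Fin n) → Fin (m i) → FreeGroup X
  /-- words spelling the free generators of the `V_i` -/
  vw : (i : Fin n) → Fin (m i) → FreeGroup X

namespace MHNNData

variable (D : MHNNData)

/-- The base group `A = ⟨X ∣ R⟩`. -/
def A : Type := PresentedGroup D.R

instance : Group D.A := by unfold A; infer_instance

/-- The canonical projection `FreeGroup X → A`. -/
def projA : FreeGroup D.X →* D.A := PresentedGroup.mk D.R

/-- The marking of the base group by its generators. -/
def genA : D.X → D.A := fun x => PresentedGroup.of x

/-- The free generators `u_{ij}` of the associated subgroup `U_i`. -/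
def u (i : Fin D.n) (j : Fin (D.m i)) : D.A := D.projA (D.uw i j)

/-- The free generators `v_{ij} = φ_i(u_{ij})` of the associated subgroup `V_i`. -/
def v (i : Fin D.n) (j : Fin (D.m i)) : D.A := D.projA (D.vw i j)

/-- The associated subgroup `U_i`. -/
def U (i : Fin D.n) : Subgroup D.A := Subgroup.closure (Set.range (D.u i))

/-- The associated subgroup `V_i`. -/
def V (i : Fin D.n) : Subgroup D.A := Subgroup.closure (Set.range (D.v i))

/-- The relators of the multiple HNN extension
`G = ⟨X, s_1, …, s_n ∣ R, s_i⁻¹ u_{ij} s_i = v_{ij}⟩`. -/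
def relsG : Set (FreeGroup (D.X ⊕ Fin D.n)) :=
  FreeGroup.map Sum.inl '' D.R ∪
    { r | ∃ (i : Fin D.n) (j : Fin (D.m i)),
        r = (FreeGroup.of (Sum.inr i))⁻¹ * FreeGroup.map Sum.inl (D.uw i j) *
            FreeGroup.of (Sum.inr i) * (FreeGroup.map Sum.inl (D.vw i j))⁻¹ }

/-- The multiple HNN extension `G`. -/
def G : Type := PresentedGroup D.relsG

instance : Group D.G := by unfold G; infer_instance

/-- The marking of `G` by the generating set `X ∪ {s_1, …, s_n}`. -/
def genG : D.X ⊕ Fin D.n → D.G := fun x => PresentedGroup.of x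

/-- Each associated subgroup `U_i`, `V_i` is free with the given (finite) free basis:
the induced maps from the free group are injective. -/
def FreeBases : Prop :=
  ∀ i : Fin D.n,
    Function.Injective (FreeGroup.lift (D.u i) : FreeGroup (Fin (D.m i)) →* D.A) ∧
    Function.Injective (FreeGroup.lift (D.v i) : FreeGroup (Fin (D.m i)) →* D.A)

/-- All associated subgroups are totally geodesic. -/
def TotallyGeodesic : Prop :=
  ∀ i : Fin D.n,
    TotallyGeodesicSub D.genA (D.u i) ∧ TotallyGeodesicSub D.genA (D.v i)

/-- The presentation is strip equidistant: `|u_{ij}| = |v_{ij}|` in `(A,X)`. -/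
def StripEquidistant : Prop :=
  ∀ (i : Fin D.n) (j : Fin (D.m i)), wlen D.genA (D.u i j) = wlen D.genA (D.v i j)

/-- `G` is an isometric multiple HNN extension: the associated subgroups are finitely
generated free, totally geodesic, and strip equidistant. -/
def IsIsometric : Prop :=
  D.FreeBases ∧ D.TotallyGeodesic ∧ D.StripEquidistant

end MHNNData


namespace MHNNData

variable (D : MHNNData)

/-- The sequence of stable letters `s_i^{±1}` of a word over `(X ∪ {s_1,…,s_n})^{±1}`,
obtained by deleting all letters of `X^{±1}` (`Sum.inl i` records `s_i`, `Sum.inr i`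
records `s_i⁻¹`). -/
def stableSeq (w : List ((D.X ⊕ Fin D.n) ⊕ (D.X ⊕ Fin D.n))) : List (Fin D.n ⊕ Fin D.n) :=
  w.filterMap fun l =>
    match l with
    | Sum.inl (Sum.inr i) => some (Sum.inl i)
    | Sum.inr (Sum.inr i) => some (Sum.inr i)
    | _ => none

end MHNNData

section Words

variable {β G : Type*} [Group G]

@[simp]
theorem eval_nil (gen : β → G) : eval gen [] = 1 := rfl

@[simp]
theorem eval_cons (gen : β → G) (l : β ⊕ β) (w : List (β ⊕ β)) :
    eval gen (l :: w) = letterEval gen l * eval gen w := by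
  simp [eval]

@[simp]
theorem eval_append (gen : β → G) (w w' : List (β ⊕ β)) :
    eval gen (w ++ w') = eval gen w * eval gen w' := by
  simp [eval]

theorem wlen_eval_le (gen : β → G) (w : List (β ⊕ β)) : wlen gen (eval gen w) ≤ w.length :=
  Nat.sInf_le ⟨w, rfl, rfl⟩

theorem Generates.exists_length_eq_wlen {gen : β → G} (h : Generates gen) (g : G) :
    ∃ w, eval gen w = g ∧ w.length = wlen gen g := by
  obtain ⟨w, hw⟩ := h g
  exact Nat.sInf_mem (s := {n : ℕ | ∃ w : List (β ⊕ β), eval gen w = g ∧ w.length = n})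
    ⟨_, w, hw, rfl⟩

theorem IsGeodesic.length_le {gen : β → G} {w w' : List (β ⊕ β)} (h : IsGeodesic gen w)
    (hw : eval gen w' = eval gen w) : w.length ≤ w'.length := by
  rw [h, ← hw]
  exact wlen_eval_le gen w'

theorem IsGeodesic.tail {gen : β → G} {l : β ⊕ β} {w : List (β ⊕ β)}
    (h : IsGeodesic gen (l :: w)) : IsGeodesic gen w := by
  refine le_antisymm (le_csInf ⟨_, w, rfl, rfl⟩ ?_) (wlen_eval_le gen w)
  rintro _ ⟨v, hv, rfl⟩
  simpa using h.length_le (w' := l :: v) (by simp [hv])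

/-- A word of `FreeGroup β`, as a list of signed letters. -/
def signedLetters (L : List (β × Bool)) : List (β ⊕ β) :=
  L.map fun p => if p.2 then Sum.inl p.1 else Sum.inr p.1

theorem eval_signedLetters (gen : β → G) (L : List (β × Bool)) :
    eval gen (signedLetters L) = FreeGroup.lift gen (FreeGroup.mk L) := by
  rw [FreeGroup.lift_mk, eval, signedLetters, List.map_map]
  congr 2
  ext ⟨x, _ | _⟩ <;> rfl

theorem freelyReduced_signedLetters {L : List (β × Bool)} (hL : FreeGroup.IsReduced L) :
    FreelyReduced (signedLetters L) := by
  refine (List.isChain_map _).2 (hL.imp ?_)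
  rintro ⟨x, _ | _⟩ ⟨y, _ | _⟩ <;> simp [IsInvPair]

theorem TGReducedGeodesic.wlen_lift_eq {κ : Type*} {gen : β → G} {f f' : κ → G}
    (h : TGReducedGeodesic gen f) (h' : TGReducedGeodesic gen f')
    (hlen : ∀ j, wlen gen (f j) = wlen gen (f' j)) (x : FreeGroup κ) :
    wlen gen (FreeGroup.lift f x) = wlen gen (FreeGroup.lift f' x) := by
  classical
  have hx := freelyReduced_signedLetters (FreeGroup.isReduced_toWord (x := x))
  rw [← FreeGroup.mk_toWord (x := x), ← eval_signedLetters, ← eval_signedLetters, h _ hx, h' _ hx]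
  simp only [hlen]

theorem freeGroup_hom_mul_eq_mul {κ : Type*} {g g' : FreeGroup κ →* G} {s : G}
    (h : ∀ j, g (.of j) * s = s * g' (.of j)) (x : FreeGroup κ) : g x * s = s * g' x := by
  have : g = (MulAut.conj s).toMonoidHom.comp g' := by
    ext j
    simp [← h j]
  simp [this]

end Words

section Britton

open HNNExtension RegularWreathProduct

universe u v

variable {A : Type u} {ι : Type v} [Group A] {F : ι → Type*} [∀ i, Group (F i)]

/-- The associated subgroup attached to the signed stable letter `e`: a subword `e, h, e⁻¹` with `h`
in this subgroup is a pinch. -/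
def pinchSubgroup (α β : ∀ i, F i →* A) : ι ⊕ ι → Subgroup A :=
  Sum.elim (fun i => (β i).range) fun i => (α i).range

/-- A sequence of syllables (a signed stable letter followed by a base group element) without
pinches. -/
def BrittonReduced (α β : ∀ i, F i →* A) (L : List ((ι ⊕ ι) × A)) : Prop :=
  L.IsChain fun p q => p.2 ∈ pinchSubgroup α β p.1 → q.1 ≠ p.1.swap

/-- The value of a sequence of syllables. -/
def syllableProd {H : Type*} [Group H] (b : A →* H) (s : ι → H) (L : List ((ι ⊕ ι) × A)) : H :=
  (L.map fun p => letterEval s p.1 * b p.2).prod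

@[simp]
theorem syllableProd_nil {H : Type*} [Group H] (b : A →* H) (s : ι → H) :
    syllableProd b s [] = 1 := by
  simp [syllableProd]

@[simp]
theorem syllableProd_cons {H : Type*} [Group H] (b : A →* H) (s : ι → H) (p : (ι ⊕ ι) × A)
    (L : List ((ι ⊕ ι) × A)) :
    syllableProd b s (p :: L) = letterEval s p.1 * b p.2 * syllableProd b s L := by
  simp [syllableProd]

/-- A member of an associated subgroup can be moved across a stable letter, keeping any quantity
that the isomorphisms between the associated subgroups preserve. -/
theorem exists_map_mul_letterEval {H M : Type*} [Group H] {b : A →* H} {s : ι → H}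
    {α β : ∀ i, F i →* A} (h : ∀ i f, b (α i f) * s i = s i * b (β i f)) {ℓ : A → M}
    (hℓ : ∀ i f, ℓ (α i f) = ℓ (β i f)) (e : ι ⊕ ι) {a : A}
    (ha : a ∈ pinchSubgroup α β e.swap) :
    ∃ a', ℓ a' = ℓ a ∧ b a * letterEval s e = letterEval s e * b a' := by
  rcases e with i | i
  · obtain ⟨f, rfl⟩ := ha
    exact ⟨β i f, (hℓ i f).symm, h i f⟩
  · obtain ⟨f, rfl⟩ := ha
    refine ⟨α i f, hℓ i f, ?_⟩
    simp only [letterEval, Sum.elim_inr]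
    rw [eq_inv_mul_iff_mul_eq, ← mul_assoc, mul_inv_eq_iff_eq_mul, h]

variable [Group ι]

/-- The product of the homomorphisms `γ i`, landing in the base of the wreath product. -/
def wreathPi (γ : ∀ i, F i →* A) : (∀ i, F i) →* A ≀ᵣ ι where
  toFun f := ⟨fun i => γ i (f i), 1⟩
  map_one' := by ext <;> simp
  map_mul' f g := by
    ext x
    · simp only [Pi.mul_apply, map_mul, mul_left]
      rw [show (1 : ι)⁻¹ * x = x by simp]
    · simp

theorem wreathPi_injective {γ : ∀ i, F i →* A} (hγ : ∀ i, Function.Injective (γ i)) :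
    Function.Injective (wreathPi γ) := fun _ _ h =>
  funext fun i => hγ i (congrFun (congrArg RegularWreathProduct.left h) i)

open Classical in
/-- The embedding of the group `A` as the coordinate `1` of the wreath product. -/
noncomputable def wreathBase : A →* A ≀ᵣ ι where
  toFun a := ⟨Pi.mulSingle 1 a, 1⟩
  map_one' := by ext <;> simp
  map_mul' a b := by ext <;> simp [Pi.mulSingle_mul]

open Classical in
theorem conj_wreathBase (i : ι) (a : A) :
    (inl i⁻¹)⁻¹ * wreathBase a * inl i⁻¹ = (⟨Pi.mulSingle i a, 1⟩ : A ≀ᵣ ι) := by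
  ext x
  · simp [wreathBase, Pi.mulSingle_apply, inv_mul_eq_one, eq_comm]
  · simp [wreathBase]

theorem eq_and_mem_of_mem_range_wreathPi {γ : ∀ i, F i →* A} {i j : ι} {a : A}
    (h : (inl i⁻¹)⁻¹ * wreathBase a * inl j⁻¹ ∈ (wreathPi γ).range) :
    i = j ∧ a ∈ (γ i).range := by
  classical
  obtain ⟨f, hf⟩ := h
  have hij : i = j := by
    have := congrArg RegularWreathProduct.right hf
    simpa [wreathPi, wreathBase, mul_inv_eq_one, eq_comm] using this
  subst hij
  rw [conj_wreathBase] at hf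
  have := congrFun (congrArg RegularWreathProduct.left hf) i
  exact ⟨rfl, f i, by simpa [wreathPi] using this⟩

/-- The isomorphism between the ranges of `wreathPi β` and `wreathPi α`. -/
noncomputable def wreathEquiv {α β : ∀ i, F i →* A} (hα : ∀ i, Function.Injective (α i))
    (hβ : ∀ i, Function.Injective (β i)) : (wreathPi β).range ≃* (wreathPi α).range :=
  (MonoidHom.ofInjective (wreathPi_injective hβ)).symm.trans
    (MonoidHom.ofInjective (wreathPi_injective hα))

theorem wreathEquiv_ofInjective {α β : ∀ i, F i →* A} (hα : ∀ i, Function.Injective (α i))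
    (hβ : ∀ i, Function.Injective (β i)) (f : ∀ i, F i) :
    wreathEquiv hα hβ (MonoidHom.ofInjective (wreathPi_injective hβ) f) =
      MonoidHom.ofInjective (wreathPi_injective hα) f := by
  simp [wreathEquiv]

/-- The exponent of a signed letter. -/
def letterSign : ι ⊕ ι → ℤˣ :=
  Sum.elim (fun _ => 1) fun _ => -1

/-- The element of the wreath product conjugating the coordinate `1` to that of the letter. -/
def letterConj (e : ι ⊕ ι) : A ≀ᵣ ι :=
  inl (e.elim id id)⁻¹

/-- The conjugating element of the first syllable. -/
def headConj : List ((ι ⊕ ι) × A) → A ≀ᵣ ι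
  | [] => 1
  | p :: _ => letterConj p.1

/-- The translation of syllables into a word of a single HNN extension of the wreath product. -/
noncomputable def wreathWord : List ((ι ⊕ ι) × A) → List (ℤˣ × (A ≀ᵣ ι))
  | [] => []
  | p :: L => (letterSign p.1, (letterConj p.1)⁻¹ * wreathBase p.2 * headConj L) :: wreathWord L

theorem mem_of_mem_toSubgroup {α β : ∀ i, F i →* A} {e e' : ι ⊕ ι} {a : A}
    (h : (letterConj e)⁻¹ * wreathBase a * letterConj e' ∈
      toSubgroup (wreathPi β).range (wreathPi α).range (letterSign e)) :
    e.elim id id = e'.elim id id ∧ a ∈ pinchSubgroup α β e := by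
  rcases e with i | i
  · exact eq_and_mem_of_mem_range_wreathPi (γ := β) h
  · exact eq_and_mem_of_mem_range_wreathPi (γ := α) h

theorem isChain_wreathWord {α β : ∀ i, F i →* A} {L : List ((ι ⊕ ι) × A)}
    (hL : BrittonReduced α β L) :
    (wreathWord L).IsChain fun p q =>
      p.2 ∈ toSubgroup (wreathPi β).range (wreathPi α).range p.1 → p.1 = q.1 := by
  induction L with
  | nil => simp [wreathWord]
  | cons p L ih =>
    cases L with
    | nil => simp [wreathWord]
    | cons q L =>
      obtain ⟨hpq, hL⟩ := List.isChain_cons_cons.1 hL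
      refine List.isChain_cons_cons.2 ⟨fun h => ?_, ih hL⟩
      obtain ⟨h1, h2⟩ := mem_of_mem_toSubgroup h
      have := hpq h2
      rcases p with ⟨i | i, a⟩ <;> rcases q with ⟨j | j, c⟩ <;> simp_all [letterSign]

section Embedding

variable {α β : ∀ i, F i →* A} (hα : ∀ i, Function.Injective (α i))
  (hβ : ∀ i, Function.Injective (β i))

/-- The base group inside the HNN extension of the wreath product. -/
noncomputable def wreathHNNBase : A →* HNNExtension (A ≀ᵣ ι) _ _ (wreathEquiv hα hβ) :=
  of.comp wreathBase

/-- The stable letters inside the HNN extension of the wreath product. -/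
noncomputable def wreathHNNStable (i : ι) : HNNExtension (A ≀ᵣ ι) _ _ (wreathEquiv hα hβ) :=
  of (inl i⁻¹) * t * (of (inl i⁻¹))⁻¹

theorem wreathHNNBase_mul_stable (i : ι) (f : F i) :
    wreathHNNBase hα hβ (α i f) * wreathHNNStable hα hβ i =
      wreathHNNStable hα hβ i * wreathHNNBase hα hβ (β i f) := by
  classical
  have key : ∀ γ : ∀ i, F i →* A, (inl i⁻¹)⁻¹ * wreathBase (γ i f) * inl i⁻¹ =
      wreathPi γ (Pi.mulSingle i f) := fun γ => by
    rw [conj_wreathBase]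
    ext x
    · by_cases hx : x = i
      · subst hx; simp [wreathPi]
      · simp [wreathPi, hx]
    · simp [wreathPi]
  have h := t_mul_of (φ := wreathEquiv hα hβ)
    (MonoidHom.ofInjective (wreathPi_injective hβ) (Pi.mulSingle i f))
  rw [wreathEquiv_ofInjective] at h
  simp only [MonoidHom.ofInjective_apply] at h
  rw [← key β, ← key α] at h
  simp only [map_mul, map_inv] at h
  simp only [wreathHNNStable, wreathHNNBase, MonoidHom.comp_apply]
  rw [← mul_right_inj (of (inl i⁻¹))⁻¹, ← mul_left_inj (of (inl i⁻¹))]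
  simp only [mul_assoc] at h ⊢
  simpa using h.symm

theorem headConj_mul_wreathWord_prod (L : List ((ι ⊕ ι) × A)) :
    of (headConj L) * ((wreathWord L).map fun x => t ^ (x.1 : ℤ) * of x.2).prod =
      syllableProd (wreathHNNBase hα hβ) (wreathHNNStable hα hβ) L := by
  induction L with
  | nil => simp [headConj, wreathWord]
  | cons p L ih =>
    rw [syllableProd_cons, ← ih]
    rcases p with ⟨i | i, a⟩ <;>
      simp [headConj, wreathWord, letterEval, letterSign, letterConj, wreathHNNStable,
        wreathHNNBase, mul_assoc]

/-- The reduced word of the single HNN extension given by a Britton reduced sequence. -/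
noncomputable def wreathReducedWord (a : A) {L : List ((ι ⊕ ι) × A)} (hL : BrittonReduced α β L) :
    NormalWord.ReducedWord (A ≀ᵣ ι) (wreathPi β).range (wreathPi α).range where
  head := wreathBase a * headConj L
  toList := wreathWord L
  chain := isChain_wreathWord hL

theorem wreathReducedWord_prod (a : A) {L : List ((ι ⊕ ι) × A)} (hL : BrittonReduced α β L) :
    (wreathReducedWord a hL).prod (wreathEquiv hα hβ) =
      wreathHNNBase hα hβ a * syllableProd (wreathHNNBase hα hβ) (wreathHNNStable hα hβ) L := by
  rw [← headConj_mul_wreathWord_prod, NormalWord.ReducedWord.prod]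
  simp [wreathReducedWord, wreathHNNBase, mul_assoc]

theorem map_fst_eq_of_wreathHNN_eq {L L' : List ((ι ⊕ ι) × A)} {a a' : A}
    (hL : BrittonReduced α β L) (hL' : BrittonReduced α β L')
    (h : wreathHNNBase hα hβ a * syllableProd (wreathHNNBase hα hβ) (wreathHNNStable hα hβ) L =
      wreathHNNBase hα hβ a' *
        syllableProd (wreathHNNBase hα hβ) (wreathHNNStable hα hβ) L') :
    L.map Prod.fst = L'.map Prod.fst := by
  induction L generalizing L' a a' with
  | nil =>
    have := (ReducedWord.map_fst_eq_and_of_prod_eq (wreathEquiv hα hβ)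
      (w₁ := wreathReducedWord a hL) (w₂ := wreathReducedWord a' hL')
      (by rwa [wreathReducedWord_prod, wreathReducedWord_prod])).1
    cases L' with
    | nil => rfl
    | cons q L' => simp [wreathReducedWord, wreathWord] at this
  | cons p L ih =>
    obtain ⟨h1, h2⟩ := ReducedWord.map_fst_eq_and_of_prod_eq (wreathEquiv hα hβ)
      (w₁ := wreathReducedWord a hL) (w₂ := wreathReducedWord a' hL')
      (by rwa [wreathReducedWord_prod, wreathReducedWord_prod])
    cases L' with
    | nil => simp [wreathReducedWord, wreathWord] at h1
    | cons q L' =>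
      have hsign : letterSign p.1 = letterSign q.1 := by
        simp only [wreathReducedWord, wreathWord, List.map_cons, List.cons.injEq] at h1
        exact h1.1
      have hmem : (letterConj p.1.swap)⁻¹ * wreathBase (a⁻¹ * a') * letterConj q.1 ∈
          toSubgroup (wreathPi β).range (wreathPi α).range (letterSign p.1.swap) := by
        have := h2 (letterSign p.1) (by simp [wreathReducedWord, wreathWord])
        rcases p with ⟨i | i, c⟩ <;>
          simpa [wreathReducedWord, headConj, letterSign, letterConj, mul_assoc] using this
      obtain ⟨hidx, hpinch⟩ := mem_of_mem_toSubgroup hmem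
      have hpq : p.1 = q.1 := by
        rcases p with ⟨i | i, c⟩ <;> rcases q with ⟨j | j, d⟩ <;> simp_all [letterSign]
      obtain ⟨c, -, hc⟩ := exists_map_mul_letterEval (wreathHNNBase_mul_stable hα hβ)
        (ℓ := fun _ => ()) (fun _ _ => rfl) p.1 hpinch
      have ha' : a' = a * (a⁻¹ * a') := by simp
      rw [ha', map_mul, syllableProd_cons, syllableProd_cons, ← hpq, mul_assoc _ _ (_ * _),
        mul_right_inj] at h
      simp only [← mul_assoc] at h
      rw [hc] at h
      simp only [mul_assoc, mul_right_inj] at h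
      simp only [← mul_assoc, ← map_mul] at h
      simp [hpq, ih hL.tail hL'.tail h]

end Embedding

/-- **Britton's lemma for multiple HNN extensions**, in the form of an overgroup of `A` with stable
letters in which the letters of a Britton reduced sequence are determined by its value. -/
theorem exists_britton_overgroup {α β : ∀ i, F i →* A} (hα : ∀ i, Function.Injective (α i))
    (hβ : ∀ i, Function.Injective (β i)) :
    ∃ (H : Type (max u v)) (_ : Group H) (b : A →* H) (s : ι → H),
      (∀ i f, b (α i f) * s i = s i * b (β i f)) ∧
      ∀ (L L' : List ((ι ⊕ ι) × A)) (a a' : A), BrittonReduced α β L → BrittonReduced α β L' →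
        b a * syllableProd b s L = b a' * syllableProd b s L' →
        L.map Prod.fst = L'.map Prod.fst :=
  ⟨_, inferInstance, wreathHNNBase hα hβ, wreathHNNStable hα hβ, wreathHNNBase_mul_stable hα hβ,
    fun _ _ a a' hL hL' h =>
      map_fst_eq_of_wreathHNN_eq (a := a) (a' := a') hα hβ hL hL' h⟩

end Britton

namespace MHNNData

variable (D : MHNNData)

theorem lift_genA (x : FreeGroup D.X) : FreeGroup.lift D.genA x = D.projA x :=
  (FreeGroup.lift_unique (f := D.genA) D.projA fun _ => rfl).symm

theorem generates_genA : Generates D.genA := fun g => by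
  obtain ⟨x, rfl⟩ := PresentedGroup.mk_surjective D.R g
  obtain ⟨L, rfl⟩ := Quot.exists_rep x
  exact ⟨signedLetters L, (eval_signedLetters _ _).trans (D.lift_genA _)⟩

theorem lift_genG_map_inl (x : FreeGroup D.X) :
    FreeGroup.lift (fun x => D.genG (Sum.inl x)) x =
      PresentedGroup.mk D.relsG (FreeGroup.map Sum.inl x) :=
  (FreeGroup.lift_unique (f := fun x => D.genG (Sum.inl x))
    ((PresentedGroup.mk D.relsG).comp (FreeGroup.map Sum.inl)) fun _ => rfl).symm

/-- The canonical homomorphism from the base group to the multiple HNN extension. -/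
def baseHom : D.A →* D.G :=
  PresentedGroup.toGroup (rels := D.R) (f := fun x => D.genG (Sum.inl x)) fun r hr =>
    (D.lift_genG_map_inl r).trans (PresentedGroup.one_of_mem (Or.inl ⟨r, hr, rfl⟩))

/-- The stable letters of the multiple HNN extension. -/
def stable (i : Fin D.n) : D.G := D.genG (Sum.inr i)

@[simp]
theorem baseHom_genA (x : D.X) : D.baseHom (D.genA x) = D.genG (Sum.inl x) :=
  PresentedGroup.toGroup.of _

theorem baseHom_projA (x : FreeGroup D.X) :
    D.baseHom (D.projA x) = PresentedGroup.mk D.relsG (FreeGroup.map Sum.inl x) := by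
  rw [← lift_genG_map_inl]
  rfl

theorem baseHom_mul_stable (i : Fin D.n) (f : FreeGroup (Fin (D.m i))) :
    D.baseHom (FreeGroup.lift (D.u i) f) * D.stable i =
      D.stable i * D.baseHom (FreeGroup.lift (D.v i) f) := by
  refine freeGroup_hom_mul_eq_mul (g := D.baseHom.comp (FreeGroup.lift (D.u i)))
    (g' := D.baseHom.comp (FreeGroup.lift (D.v i))) (fun j => ?_) f
  simp only [MonoidHom.comp_apply, FreeGroup.lift_apply_of, u, v, baseHom_projA]
  have h := PresentedGroup.mk_eq_mk_of_mul_inv_mem (rels := D.relsG) (Or.inr ⟨i, j, rfl⟩)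
  rw [map_mul, map_mul, map_inv, mul_assoc, inv_mul_eq_iff_eq_mul] at h
  exact h

/-- The universal property of the multiple HNN extension, for homomorphisms out of it that are
prescribed on the base group and the stable letters. -/
theorem exists_hom {H : Type*} [Group H] (b : D.A →* H) (s : Fin D.n → H)
    (h : ∀ i j, b (D.u i j) * s i = s i * b (D.v i j)) :
    ∃ f : D.G →* H, (∀ a, f (D.baseHom a) = b a) ∧ ∀ i, f (D.stable i) = s i := by
  have hmap : ∀ x, FreeGroup.lift (Sum.elim (b ∘ D.genA) s) (FreeGroup.map Sum.inl x) =
      b (D.projA x) := fun x => by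
    have : (FreeGroup.lift (Sum.elim (b ∘ D.genA) s)).comp (FreeGroup.map Sum.inl) =
        b.comp D.projA := by
      ext x
      simp; rfl
    exact DFunLike.congr_fun this x
  have hrels : ∀ r ∈ D.relsG, FreeGroup.lift (Sum.elim (b ∘ D.genA) s) r = 1 := by
    rintro _ (⟨r, hr, rfl⟩ | ⟨i, j, rfl⟩)
    · rw [hmap, show D.projA r = 1 from PresentedGroup.one_of_mem hr, map_one]
    · simp only [map_mul, map_inv, hmap, FreeGroup.lift_apply_of, Sum.elim_inr]
      have := h i j
      simp only [u, v] at this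
      rw [mul_assoc (s i)⁻¹, this]
      simp
  refine ⟨PresentedGroup.toGroup hrels, fun a => ?_, fun i => PresentedGroup.toGroup.of hrels⟩
  obtain ⟨x, rfl⟩ := PresentedGroup.mk_surjective D.R a
  exact (congrArg _ (D.baseHom_projA x)).trans (hmap x)

theorem map_fst_eq_of_syllableProd_eq (hfree : D.FreeBases)
    {L L' : List ((Fin D.n ⊕ Fin D.n) × D.A)} {a a' : D.A}
    (hL : BrittonReduced (fun i => FreeGroup.lift (D.u i)) (fun i => FreeGroup.lift (D.v i)) L)
    (hL' : BrittonReduced (fun i => FreeGroup.lift (D.u i)) (fun i => FreeGroup.lift (D.v i)) L')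
    (h : D.baseHom a * syllableProd D.baseHom D.stable L =
      D.baseHom a' * syllableProd D.baseHom D.stable L') :
    L.map Prod.fst = L'.map Prod.fst := by
  rcases isEmpty_or_nonempty (Fin D.n) with _ | ⟨⟨i⟩⟩
  · exact Subsingleton.elim _ _
  have : NeZero D.n := ⟨by rintro h; rw [h] at i; exact i.elim0⟩
  let _ : Group (Fin D.n) := inferInstanceAs (Group (Multiplicative (Fin D.n)))
  obtain ⟨H, _, b, s, hbs, hH⟩ :=
    exists_britton_overgroup (fun i => (hfree i).1) (fun i => (hfree i).2)
  obtain ⟨f, hfb, hfs⟩ := D.exists_hom b s fun i j => by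
    simpa using hbs i (FreeGroup.of j)
  have hf : ∀ L, f (syllableProd D.baseHom D.stable L) = syllableProd b s L := fun L => by
    induction L with
    | nil => simp
    | cons p L ih => rcases p with ⟨i | i, c⟩ <;> simp [letterEval, hfb, hfs, ih]
  refine hH L L' a a' hL hL' ?_
  simpa [hf, hfb] using congrArg f h

/-- The decomposition of a word into a leading base group element and syllables. -/
def syllables : List ((D.X ⊕ Fin D.n) ⊕ (D.X ⊕ Fin D.n)) →
    D.A × List ((Fin D.n ⊕ Fin D.n) × D.A)
  | [] => (1, [])
  | Sum.inl (Sum.inl x) :: w => (D.genA x * (syllables w).1, (syllables w).2)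
  | Sum.inr (Sum.inl x) :: w => ((D.genA x)⁻¹ * (syllables w).1, (syllables w).2)
  | Sum.inl (Sum.inr i) :: w => (1, (Sum.inl i, (syllables w).1) :: (syllables w).2)
  | Sum.inr (Sum.inr i) :: w => (1, (Sum.inr i, (syllables w).1) :: (syllables w).2)

theorem map_fst_syllables (w : List ((D.X ⊕ Fin D.n) ⊕ (D.X ⊕ Fin D.n))) :
    (D.syllables w).2.map Prod.fst = D.stableSeq w := by
  induction w with
  | nil => rfl
  | cons l w ih =>
    rcases l with (x | i) | (x | i) <;> simpa [syllables, stableSeq] using ih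

theorem eval_eq_syllables (w : List ((D.X ⊕ Fin D.n) ⊕ (D.X ⊕ Fin D.n))) :
    eval D.genG w = D.baseHom (D.syllables w).1 *
      syllableProd D.baseHom D.stable (D.syllables w).2 := by
  induction w with
  | nil => simp [syllables]
  | cons l w ih =>
    rcases l with (x | i) | (x | i) <;> simp [syllables, ih, letterEval, stable, mul_assoc]

theorem exists_of_syllables_eq_cons {w : List ((D.X ⊕ Fin D.n) ⊕ (D.X ⊕ Fin D.n))}
    {p : (Fin D.n ⊕ Fin D.n) × D.A} {L : List ((Fin D.n ⊕ Fin D.n) × D.A)}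
    (h : (D.syllables w).2 = p :: L) :
    ∃ (q : List (D.X ⊕ D.X)) (r : List ((D.X ⊕ Fin D.n) ⊕ (D.X ⊕ Fin D.n))),
      eval D.genA q = (D.syllables w).1 ∧ w.length = q.length + (r.length + 1) ∧
      eval D.genG w =
        D.baseHom (D.syllables w).1 * (letterEval D.stable p.1 * eval D.genG r) := by
  induction w with
  | nil => simp [syllables] at h
  | cons l w ih =>
    rcases l with (x | i) | (x | i)
    · obtain ⟨q, r, hq, hlen, hw⟩ := ih h
      refine ⟨Sum.inl x :: q, r, ?_, ?_, ?_⟩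
      · simp [syllables, hq, letterEval]
      · simp only [List.length_cons]; omega
      · simp [syllables, hw, letterEval, mul_assoc]
    · obtain ⟨rfl, -⟩ := List.cons.inj h
      exact ⟨[], w, rfl, by simp, by simp [syllables, letterEval, stable]⟩
    · obtain ⟨q, r, hq, hlen, hw⟩ := ih h
      refine ⟨Sum.inr x :: q, r, ?_, ?_, ?_⟩
      · simp [syllables, hq, letterEval]
      · simp only [List.length_cons]; omega
      · simp [syllables, hw, letterEval, mul_assoc]
    · obtain ⟨rfl, -⟩ := List.cons.inj h
      exact ⟨[], w, rfl, by simp, by simp [syllables, letterEval, stable]⟩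

theorem exists_word_eval_eq_baseHom (a : D.A) :
    ∃ w, eval D.genG w = D.baseHom a ∧ w.length = wlen D.genA a := by
  obtain ⟨q, rfl, hq⟩ := D.generates_genA.exists_length_eq_wlen a
  refine ⟨q.map (Sum.map Sum.inl Sum.inl), ?_, by simpa using hq⟩
  clear hq
  induction q with
  | nil => simp
  | cons l q ih => rcases l with x | x <;> simp [letterEval, ih]

variable {D}

theorem IsIsometric.wlen_lift_eq (h : D.IsIsometric) (i : Fin D.n) (f : FreeGroup (Fin (D.m i))) :
    wlen D.genA (FreeGroup.lift (D.u i) f) = wlen D.genA (FreeGroup.lift (D.v i) f) :=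
  (h.2.1 i).1.2.wlen_lift_eq (h.2.1 i).2.2 (h.2.2 i) f

theorem IsIsometric.ne_swap_of_isGeodesic (h : D.IsIsometric) {e : Fin D.n ⊕ Fin D.n}
    {l : (D.X ⊕ Fin D.n) ⊕ (D.X ⊕ Fin D.n)} {w : List ((D.X ⊕ Fin D.n) ⊕ (D.X ⊕ Fin D.n))}
    (hl : letterEval D.genG l = letterEval D.stable e) (hw : IsGeodesic D.genG (l :: w))
    {p : (Fin D.n ⊕ Fin D.n) × D.A} {L : List ((Fin D.n ⊕ Fin D.n) × D.A)}
    (hp : (D.syllables w).2 = p :: L)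
    (hmem : (D.syllables w).1 ∈
      pinchSubgroup (fun i => FreeGroup.lift (D.u i)) (fun i => FreeGroup.lift (D.v i)) e) :
    p.1 ≠ e.swap := by
  intro hpe
  obtain ⟨q, r, hq, hlen, heval⟩ := D.exists_of_syllables_eq_cons hp
  obtain ⟨a, ha, hswap⟩ := exists_map_mul_letterEval D.baseHom_mul_stable (ℓ := wlen D.genA)
    h.wlen_lift_eq e.swap (by simpa using hmem)
  obtain ⟨w', hw', hlen'⟩ := D.exists_word_eval_eq_baseHom a
  have hinv : letterEval D.stable e * letterEval D.stable e.swap = 1 := by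
    rcases e with i | i <;> simp [letterEval]
  have := hw.length_le (w' := w' ++ r) (by
    rw [eval_append, eval_cons, heval, hw', hl, hpe, ← mul_assoc (D.baseHom _), hswap,
      ← mul_assoc, ← mul_assoc, hinv, one_mul])
  have hle := wlen_eval_le D.genA q
  rw [hq, ← ha, ← hlen'] at hle
  simp only [List.length_cons, List.length_append] at this
  omega

theorem IsIsometric.brittonReduced_syllables (h : D.IsIsometric)
    {w : List ((D.X ⊕ Fin D.n) ⊕ (D.X ⊕ Fin D.n))} (hw : IsGeodesic D.genG w) :
    BrittonReduced (fun i => FreeGroup.lift (D.u i)) (fun i => FreeGroup.lift (D.v i))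
      (D.syllables w).2 := by
  induction w with
  | nil => exact List.isChain_nil
  | cons l w ih =>
    have hcons : ∀ e, letterEval D.genG l = letterEval D.stable e →
        BrittonReduced (fun i => FreeGroup.lift (D.u i)) (fun i => FreeGroup.lift (D.v i))
          ((e, (D.syllables w).1) :: (D.syllables w).2) := fun e hl =>
      List.isChain_cons.2 ⟨fun p hp hmem => by
        obtain ⟨L, hL⟩ := List.head?_eq_some_iff.1 hp
        exact h.ne_swap_of_isGeodesic hl hw hL hmem, ih hw.tail⟩
    rcases l with (x | i) | (x | i)
    · exact ih hw.tail
    · exact hcons (Sum.inl i) rfl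
    · exact ih hw.tail
    · exact hcons (Sum.inr i) rfl

end MHNNData

open MHNNData in
/-- In an isometric multiple HNN extension of a finitely presented base
group, any two geodesic words representing the same element of `G` have parallel stable
letter structure. -/
theorem isometric_mhnn_parallel_stable_letter_structure (D : MHNNData) (hfp : D.R.Finite)
    (hiso : D.IsIsometric) :
    ∀ w w' : List ((D.X ⊕ Fin D.n) ⊕ (D.X ⊕ Fin D.n)),
      IsGeodesic D.genG w → IsGeodesic D.genG w' →
      eval D.genG w = eval D.genG w' →
      D.stableSeq w = D.stableSeq w' := by
  intro w w' hw hw' heq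
  rw [eval_eq_syllables, eval_eq_syllables] at heq
  rw [← map_fst_syllables, ← map_fst_syllables]
  exact D.map_fst_eq_of_syllableProd_eq hiso.1 (hiso.brittonReduced_syllables hw)
    (hiso.brittonReduced_syllables hw') heq

end ACPaper
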